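/- Hilbert's stage-III system (quantifier-free primitive recursive arithmetic with the induction rule) is consistent: the formula ¬(0 = 0) is not derivable in it. -/

import Mathlib

/-- Terms of Hilbert's stage-III system: variables, 0, successor, predecessor `δ`,
and applications of primitive recursively defined function symbols (numbered in
their order of definition). -/
inductive Tm3 where
  | var : ℕ → Tm3
  | zero : Tm3
  | succ : Tm3 → Tm3
  | pred : Tm3 → Tm3
  | app : ℕ → List Tm3 → Tm3

/-- Substitution of terms for variables in a term. -/
def Tm3.subst (σ : ℕ → Tm3) : Tm3 → Tm3
  | .var n => σ n
  | .zero => .zero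
  | .succ t => .succ (t.subst σ)
  | .pred t => .pred (t.subst σ)
  | .app k ts => .app k (ts.attach.map fun t => t.1.subst σ)
decreasing_by
  all_goals first
    | decreasing_tactic
    | (simp_wf
       have := List.sizeOf_lt_of_mem t.2
       omega)

/-- A primitive recursive definition of a function symbol `φ` of arity `arity + 1`:
`φ(0, b₁,…,bₙ) = base` where in `base` the variable `i` stands for `b_{i+1}`, and
`φ(a+1, b₁,…,bₙ) = step` where in `step` variable `0` stands for `a`, variable `1`
stands for the recursion value `φ(a, b₁,…,bₙ)`, and variable `i+2` stands for `b_{i+1}`. -/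
structure PRDefn where
  arity : ℕ
  base : Tm3
  step : Tm3

/-- Well-formedness of a term relative to an environment `E` of primitive recursive
definitions: all function symbols have index `< fb` (only previously defined symbols),
are applied to the correct number of arguments, and all variables are `< vb`. -/
inductive TmOk (E : List PRDefn) (fb vb : ℕ) : Tm3 → Prop where
  | var {n : ℕ} : n < vb → TmOk E fb vb (.var n)
  | zero : TmOk E fb vb .zero
  | succ {t : Tm3} : TmOk E fb vb t → TmOk E fb vb (.succ t)
  | pred {t : Tm3} : TmOk E fb vb t → TmOk E fb vb (.pred t)
  | app {k : ℕ} {ts : List Tm3} (hk : k < fb) (hkE : k < E.length) :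
      ts.length = (E.get ⟨k, hkE⟩).arity + 1 →
      (∀ t ∈ ts, TmOk E fb vb t) → TmOk E fb vb (.app k ts)

/-- A well-formed environment: the defining terms of the `k`-th function symbol use
only function symbols introduced earlier (index `< k`) and only the allowed variables. -/
def EnvWF (E : List PRDefn) : Prop :=
  ∀ (k : ℕ) (hk : k < E.length),
    TmOk E k (E.get ⟨k, hk⟩).arity (E.get ⟨k, hk⟩).base ∧
    TmOk E k ((E.get ⟨k, hk⟩).arity + 2) (E.get ⟨k, hk⟩).step

/-- Formulas of Hilbert's stage-III system. -/
inductive Fm3 where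
  | eq : Tm3 → Tm3 → Fm3
  | neg : Fm3 → Fm3
  | conj : Fm3 → Fm3 → Fm3
  | disj : Fm3 → Fm3 → Fm3
  | imp : Fm3 → Fm3 → Fm3

/-- Substitution of terms for variables in a formula. -/
def Fm3.subst (σ : ℕ → Tm3) : Fm3 → Fm3
  | .eq s t => .eq (s.subst σ) (t.subst σ)
  | .neg A => .neg (A.subst σ)
  | .conj A B => .conj (A.subst σ) (B.subst σ)
  | .disj A B => .disj (A.subst σ) (B.subst σ)
  | .imp A B => .imp (A.subst σ) (B.subst σ)

/-- Substitution of a single term for a single variable in a formula. -/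
def Fm3.subst1 (A : Fm3) (x : ℕ) (t : Tm3) : Fm3 :=
  A.subst (fun n => if n = x then t else .var n)

/-- Derivability in Hilbert's stage-III system over an environment `E` of primitive
recursive definitions: propositional schemas (1)–(12), equality schemas, number
axioms `¬(a+1 = 0)` and `δ(a+1) = a`, the defining equations of the primitive
recursively defined function symbols, modus ponens, and the induction rule. -/
inductive Deriv3 (E : List PRDefn) : Fm3 → Prop where
  | ax1 (A B : Fm3) : Deriv3 E (A.imp (B.imp A))
  | ax2 (A B : Fm3) : Deriv3 E ((A.imp (A.imp B)).imp (A.imp B))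
  | ax3 (A B C : Fm3) : Deriv3 E ((A.imp (B.imp C)).imp (B.imp (A.imp C)))
  | ax4 (A B C : Fm3) : Deriv3 E ((B.imp C).imp ((A.imp B).imp (A.imp C)))
  | ax5 (A B : Fm3) : Deriv3 E ((A.conj B).imp A)
  | ax6 (A B : Fm3) : Deriv3 E ((A.conj B).imp B)
  | ax7 (A B : Fm3) : Deriv3 E (A.imp (B.imp (A.conj B)))
  | ax8 (A B : Fm3) : Deriv3 E (A.imp (A.disj B))
  | ax9 (A B : Fm3) : Deriv3 E (B.imp (A.disj B))
  | ax10 (A B C : Fm3) : Deriv3 E ((A.imp C).imp ((B.imp C).imp ((A.disj B).imp C)))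
  | ax11 (A B : Fm3) : Deriv3 E (A.imp (A.neg.imp B))
  | ax12 (A B : Fm3) : Deriv3 E ((A.imp B).imp ((A.neg.imp B).imp B))
  | eqRefl (a : Tm3) : Deriv3 E (.eq a a)
  | eqSubst (a b : Tm3) (A : Fm3) (x : ℕ) :
      Deriv3 E ((Fm3.eq a b).imp ((A.subst1 x a).imp (A.subst1 x b)))
  | succNeZero (a : Tm3) : Deriv3 E (.neg (.eq a.succ .zero))
  | predSucc (a : Tm3) : Deriv3 E (.eq a.succ.pred a)
  | defBase (k : ℕ) (hk : k < E.length) (ts : List Tm3)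
      (hlen : ts.length = (E.get ⟨k, hk⟩).arity) :
      Deriv3 E (.eq (.app k (.zero :: ts))
        ((E.get ⟨k, hk⟩).base.subst fun i => ts.getD i .zero))
  | defStep (k : ℕ) (hk : k < E.length) (t : Tm3) (ts : List Tm3)
      (hlen : ts.length = (E.get ⟨k, hk⟩).arity) :
      Deriv3 E (.eq (.app k (t.succ :: ts))
        ((E.get ⟨k, hk⟩).step.subst fun i =>
          (t :: Tm3.app k (t :: ts) :: ts).getD i .zero))
  | mp (A B : Fm3) : Deriv3 E A → Deriv3 E (A.imp B) → Deriv3 E B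
  | ind (A : Fm3) (x : ℕ) (t : Tm3) :
      Deriv3 E (A.subst1 x .zero) →
      Deriv3 E (A.imp (A.subst1 x (.succ (.var x)))) →
      Deriv3 E (A.subst1 x t)

/-- Value of a term under an interpretation `I` of the function symbols and a valuation `v`. -/
def Tm3.eval (I : ℕ → List ℕ → ℕ) (v : ℕ → ℕ) : Tm3 → ℕ
  | .var n => v n
  | .zero => 0
  | .succ t => t.eval I v + 1
  | .pred t => t.eval I v - 1
  | .app k ts => I k (ts.attach.map fun t => t.1.eval I v)
decreasing_by
  all_goals first
    | decreasing_tactic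
    | (simp_wf
       have := List.sizeOf_lt_of_mem t.2
       omega)

theorem Tm3.eval_app (I : ℕ → List ℕ → ℕ) (v : ℕ → ℕ) (k : ℕ) (ts : List Tm3) :
    (Tm3.app k ts).eval I v = I k (ts.map (Tm3.eval I v)) := by
  rw [Tm3.eval, List.attach_map_val (f := Tm3.eval I v)]

theorem Tm3.eval_subst (I : ℕ → List ℕ → ℕ) (v : ℕ → ℕ) (σ : ℕ → Tm3) (t : Tm3) :
    (t.subst σ).eval I v = t.eval I fun n => (σ n).eval I v := by
  induction t using Tm3.subst.induct with
  | case1 n => simp [Tm3.subst, Tm3.eval]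
  | case2 => simp [Tm3.subst, Tm3.eval]
  | case3 t ih => simp [Tm3.subst, Tm3.eval, ih]
  | case4 t ih => simp [Tm3.subst, Tm3.eval, ih]
  | case5 k ts ih =>
    rw [Tm3.subst, List.attach_map_val (f := Tm3.subst σ), Tm3.eval_app, Tm3.eval_app,
      List.map_map]
    exact congrArg (I k) (List.map_congr_left fun t ht => ih ⟨t, ht⟩)

/-- A well-formed term only depends on the symbols and variables it is allowed to use. -/
theorem TmOk.eval_congr {E : List PRDefn} {fb vb : ℕ} {t : Tm3} (h : TmOk E fb vb t)
    {I J : ℕ → List ℕ → ℕ} (hIJ : ∀ k < fb, I k = J k) (v : ℕ → ℕ) :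
    t.eval I v = t.eval J v := by
  induction h with
  | var _ => simp [Tm3.eval]
  | zero => simp [Tm3.eval]
  | succ _ ih => simp [Tm3.eval, ih]
  | pred _ ih => simp [Tm3.eval, ih]
  | app hk _ _ _ ih =>
    rw [Tm3.eval_app, Tm3.eval_app, hIJ _ hk]
    exact congrArg _ (List.map_congr_left ih)

/-- The function defined by `d` when the symbols in its defining terms are interpreted by `I`. -/
def PRDefn.interp (d : PRDefn) (I : ℕ → List ℕ → ℕ) : List ℕ → ℕ
  | [] => 0
  | a :: bs =>
    Nat.rec (d.base.eval I fun i => bs.getD i 0)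
      (fun n r => d.step.eval I fun i => (n :: r :: bs).getD i 0) a

theorem PRDefn.interp_congr {E : List PRDefn} (hE : EnvWF E) {k : ℕ} (hk : k < E.length)
    {I J : ℕ → List ℕ → ℕ} (hIJ : ∀ j < k, I j = J j) :
    (E.get ⟨k, hk⟩).interp I = (E.get ⟨k, hk⟩).interp J := by
  funext args
  cases args with
  | nil => rfl
  | cons a bs =>
    simp only [PRDefn.interp, (hE k hk).1.eval_congr hIJ, (hE k hk).2.eval_congr hIJ]

/-- The interpretation in which only the first `n` symbols of `E` have their intended meaning. -/
def stageInterp (E : List PRDefn) : ℕ → ℕ → List ℕ → ℕ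
  | 0 => fun _ _ => 0
  | n + 1 => Function.update (stageInterp E n) n
      (if hn : n < E.length then (E.get ⟨n, hn⟩).interp (stageInterp E n) else fun _ => 0)

/-- The standard interpretation of the function symbols of `E`. -/
def stdInterp (E : List PRDefn) (k : ℕ) : List ℕ → ℕ :=
  stageInterp E (k + 1) k

theorem stageInterp_eq_stdInterp (E : List PRDefn) {n k : ℕ} (h : k < n) :
    stageInterp E n k = stdInterp E k := by
  induction n, h using Nat.le_induction with
  | base => rfl
  | succ n hn ih =>
    rw [← ih, stageInterp, Function.update_of_ne (Nat.ne_of_lt hn)]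

theorem stdInterp_eq {E : List PRDefn} (hE : EnvWF E) {k : ℕ} (hk : k < E.length) :
    stdInterp E k = (E.get ⟨k, hk⟩).interp (stdInterp E) := by
  rw [stdInterp, stageInterp, Function.update_self, dif_pos hk]
  exact PRDefn.interp_congr hE hk fun j hj => stageInterp_eq_stdInterp E hj

/-- Truth of a formula under an interpretation and a valuation. -/
def Fm3.Holds (I : ℕ → List ℕ → ℕ) (v : ℕ → ℕ) : Fm3 → Prop
  | .eq s t => s.eval I v = t.eval I v
  | .neg A => ¬ A.Holds I v
  | .conj A B => A.Holds I v ∧ B.Holds I v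
  | .disj A B => A.Holds I v ∨ B.Holds I v
  | .imp A B => A.Holds I v → B.Holds I v

theorem Fm3.holds_subst (I : ℕ → List ℕ → ℕ) (v : ℕ → ℕ) (σ : ℕ → Tm3) (A : Fm3) :
    (A.subst σ).Holds I v ↔ A.Holds I fun n => (σ n).eval I v := by
  induction A <;> simp_all [Fm3.subst, Fm3.Holds, Tm3.eval_subst]

theorem Fm3.holds_subst1 (I : ℕ → List ℕ → ℕ) (v : ℕ → ℕ) (A : Fm3) (x : ℕ) (t : Tm3) :
    (A.subst1 x t).Holds I v ↔ A.Holds I (Function.update v x (t.eval I v)) := by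
  rw [Fm3.subst1, Fm3.holds_subst]
  have h : (fun n => (if n = x then t else Tm3.var n).eval I v) =
      Function.update v x (t.eval I v) := by
    funext n
    by_cases hn : n = x
    · simp [hn]
    · simp [hn, Tm3.eval]
  rw [h]

theorem Tm3.eval_getD (I : ℕ → List ℕ → ℕ) (v : ℕ → ℕ) (ts : List Tm3) (i : ℕ) :
    (ts.getD i .zero).eval I v = (ts.map (Tm3.eval I v)).getD i 0 := by
  have h : Tm3.eval I v .zero = 0 := by rw [Tm3.eval]
  rw [← h, List.getD_map]

/-- Every derivable formula is true in the standard interpretation. -/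
theorem Deriv3.sound {E : List PRDefn} (hE : EnvWF E) {A : Fm3} (h : Deriv3 E A) (v : ℕ → ℕ) :
    A.Holds (stdInterp E) v := by
  induction h generalizing v with
  | eqRefl a => exact rfl
  | eqSubst a b A x =>
    intro hab hA
    rw [Fm3.holds_subst1] at hA ⊢
    rwa [← (show a.eval _ v = b.eval _ v from hab)]
  | succNeZero a => simp [Fm3.Holds, Tm3.eval]
  | predSucc a => simp [Fm3.Holds, Tm3.eval]
  | defBase k hk ts hlen =>
    rw [Fm3.Holds, Tm3.eval_app, stdInterp_eq hE hk, Tm3.eval_subst]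
    simp only [Tm3.eval_getD, List.map_cons, PRDefn.interp, Tm3.eval]
    rfl
  | defStep k hk t ts hlen =>
    rw [Fm3.Holds, Tm3.eval_app, stdInterp_eq hE hk, Tm3.eval_subst]
    simp only [Tm3.eval_getD, List.map_cons, Tm3.eval_app, stdInterp_eq hE hk, PRDefn.interp,
      Tm3.eval]
  | mp A B _ _ ihA ihAB => exact ihAB v (ihA v)
  | ind A x t _ _ ih0 ihs =>
    rw [Fm3.holds_subst1]
    induction t.eval (stdInterp E) v with
    | zero => simpa [Fm3.holds_subst1, Tm3.eval] using ih0 v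
    | succ n ih =>
      simpa [Fm3.holds_subst1, Tm3.eval] using
        (Fm3.holds_subst1 _ _ A x _).1 (ihs (Function.update v x n) ih)
  | _ => simp only [Fm3.Holds]; tauto

/-- Hilbert's stage-III system (quantifier-free primitive recursive arithmetic with
the induction rule) is consistent: ¬(0 = 0) is not derivable, for any well-formed
environment of primitive recursive definitions. -/
theorem stageIII_consistent (E : List PRDefn) (hE : EnvWF E) :
    ¬ Deriv3 E (Fm3.neg (Fm3.eq Tm3.zero Tm3.zero)) := by
  exact fun h => h.sound hE (fun _ => 0) rfl
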